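/- Let κ satisfy the energy, consistency, and domination principles, let μ ∈ E⁺ and A ⊂ X, and let 𝔠_A be the collection of all compact subsets of A, upward directed by inclusion. Then: (a) the net (μ^K)_{K ∈ 𝔠_A} of inner balayages converges to μ^A both strongly (‖μ^K − μ^A‖ → 0) and vaguely; (b) the net of potentials (κμ^K)_{K ∈ 𝔠_A} increases pointwise on X (κμ^{K₁} ≤ κμ^{K₂} whenever K₁ ⊂ K₂) and κμ^A(x) = sup_{K ∈ 𝔠_A} κμ^K(x) = lim_{K ↑ A} κμ^K(x) for every x ∈ X. -/

import Mathlib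

open MeasureTheory Filter Topology Set
open scoped ENNReal NNReal

namespace Balayage

variable {X : Type*} [TopologicalSpace X] [T2Space X] [LocallyCompactSpace X]
  [MeasurableSpace X] [BorelSpace X]

/-- The potential `κμ(x) := ∫ κ(x,y) dμ(y)`. -/
noncomputable def pot (κ : X → X → ℝ≥0∞) (μ : Measure X) (x : X) : ℝ≥0∞ :=
  ∫⁻ y, κ x y ∂μ

/-- The mutual energy `κ(μ,ν) := ∬ κ(x,y) d(μ⊗ν)(x,y)`. -/
noncomputable def energy (κ : X → X → ℝ≥0∞) (μ ν : Measure X) : ℝ≥0∞ :=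
  ∫⁻ x, pot κ ν x ∂μ

/-- A positive Radon measure: locally finite and inner regular. -/
def IsRadon (μ : Measure X) : Prop :=
  μ.InnerRegular ∧ IsLocallyFiniteMeasure μ

/-- `E⁺`: the positive Radon measures of finite energy. -/
def Eplus (κ : X → X → ℝ≥0∞) : Set (Measure X) :=
  {μ | IsRadon μ ∧ energy κ μ μ < ⊤}

/-- `μ` is concentrated on `A`: `A` is `μ`-measurable and `X∖A` is locally `μ`-negligible. -/
def ConcOn (μ : Measure X) (A : Set X) : Prop :=
  NullMeasurableSet A μ ∧ ∀ K : Set X, IsCompact K → μ (Aᶜ ∩ K) = 0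

/-- `E⁺_A`: measures of finite energy concentrated on `A`. -/
def EplusOn (κ : X → X → ℝ≥0∞) (A : Set X) : Set (Measure X) :=
  {μ ∈ Eplus κ | ConcOn μ A}

/-- The inner capacity `c_*(A)`. -/
noncomputable def innerCap (κ : X → X → ℝ≥0∞) (A : Set X) : ℝ≥0∞ :=
  (⨅ μ ∈ {μ ∈ EplusOn κ A | μ Set.univ = 1}, energy κ μ μ)⁻¹

/-- `P` holds nearly everywhere on `A`: the set where it fails has inner capacity zero. -/
def NEOn (κ : X → X → ℝ≥0∞) (A : Set X) (P : X → Prop) : Prop :=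
  innerCap κ {x | x ∈ A ∧ ¬ P x} = 0

/-- The outer capacity `c^*(A)`. -/
noncomputable def outerCap (κ : X → X → ℝ≥0∞) (A : Set X) : ℝ≥0∞ :=
  ⨅ D ∈ {D : Set X | IsOpen D ∧ A ⊆ D}, innerCap κ D

/-- `P` holds quasi-everywhere on `A`: the set where it fails has outer capacity zero. -/
def QEOn (κ : X → X → ℝ≥0∞) (A : Set X) (P : X → Prop) : Prop :=
  outerCap κ {x | x ∈ A ∧ ¬ P x} = 0

/-- The class `Λ_{A,μ}` of measures `ν ∈ E⁺` with `κν ≥ κμ` n.e. on `A`. -/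
def InnerLam (κ : X → X → ℝ≥0∞) (A : Set X) (μ : Measure X) : Set (Measure X) :=
  {ν ∈ Eplus κ | NEOn κ A (fun x => pot κ μ x ≤ pot κ ν x)}

/-- The class `Λ*_{A,μ}` of measures `ν ∈ E⁺` with `κν ≥ κμ` q.e. on `A`. -/
def OuterLam (κ : X → X → ℝ≥0∞) (A : Set X) (μ : Measure X) : Set (Measure X) :=
  {ν ∈ Eplus κ | QEOn κ A (fun x => pot κ μ x ≤ pot κ ν x)}

/-- `b` is the inner balayage `μ^A`: the measure of minimal potential in `Λ_{A,μ}`. -/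
def IsInnerBal (κ : X → X → ℝ≥0∞) (A : Set X) (μ b : Measure X) : Prop :=
  b ∈ InnerLam κ A μ ∧ ∀ ν ∈ InnerLam κ A μ, ∀ x, pot κ b x ≤ pot κ ν x

/-- `b` is the outer balayage `μ^{*A}`: the measure of minimal potential in `Λ*_{A,μ}`. -/
def IsOuterBal (κ : X → X → ℝ≥0∞) (A : Set X) (μ b : Measure X) : Prop :=
  b ∈ OuterLam κ A μ ∧ ∀ ν ∈ OuterLam κ A μ, ∀ x, pot κ b x ≤ pot κ ν x

/-- The strong (energy) distance `‖μ − ν‖`. -/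
noncomputable def strDist (κ : X → X → ℝ≥0∞) (μ ν : Measure X) : ℝ :=
  Real.sqrt ((energy κ μ μ).toReal - 2 * (energy κ μ ν).toReal + (energy κ ν ν).toReal)

/-- The energy principle (strict positive definiteness). -/
def EnergyPrinciple (κ : X → X → ℝ≥0∞) : Prop :=
  ∀ μ ∈ Eplus κ, ∀ ν ∈ Eplus κ,
    2 * energy κ μ ν ≤ energy κ μ μ + energy κ ν ν ∧
      (2 * energy κ μ ν = energy κ μ μ + energy κ ν ν → μ = ν)

/-- Vague convergence of a net of measures along a filter. -/
def VagueConv {ι : Type*} (F : Filter ι) (m : ι → Measure X) (ν : Measure X) : Prop :=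
  ∀ f : X → ℝ, Continuous f → HasCompactSupport f →
    Tendsto (fun i => ∫ x, f x ∂(m i)) F (nhds (∫ x, f x ∂ν))

/-- A net of measures is strong Cauchy (for the energy metric) along a filter. -/
def StrongCauchy (κ : X → X → ℝ≥0∞) {ι : Type*} (F : Filter ι) (m : ι → Measure X) : Prop :=
  ∀ ε : ℝ, 0 < ε → ∃ s ∈ F, ∀ i ∈ s, ∀ j ∈ s, strDist κ (m i) (m j) < ε

/-- The consistency principle: every strong Cauchy net in `E⁺` converges strongly
to each of its vague limit points. -/
def Consistent (κ : X → X → ℝ≥0∞) : Prop :=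
  ∀ (ι : Type) (F : Filter ι) (m : ι → Measure X), F.NeBot →
    (∀ i, m i ∈ Eplus κ) → StrongCauchy κ F m →
    ∀ ν : Measure X, (∃ G : Filter ι, G ≤ F ∧ G.NeBot ∧ VagueConv G m ν) →
      Tendsto (fun i => strDist κ (m i) ν) F (nhds 0)

/-- The domination principle. -/
def Domination (κ : X → X → ℝ≥0∞) : Prop :=
  ∀ μ ∈ Eplus κ, ∀ ν ∈ Eplus κ,
    (∀ᵐ x ∂μ, pot κ μ x ≤ pot κ ν x) → ∀ x, pot κ μ x ≤ pot κ ν x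

/-- A kernel: symmetric and lower semicontinuous. -/
structure IsKernel (κ : X → X → ℝ≥0∞) : Prop where
  symm : ∀ x y, κ x y = κ y x
  lsc : LowerSemicontinuous (Function.uncurry κ)

/-- `E'_A`: the strong closure of `E⁺_A` within `E⁺`. -/
def EclosOn (κ : X → X → ℝ≥0∞) (A : Set X) : Set (Measure X) :=
  {ν ∈ Eplus κ | ∀ ε : ℝ, 0 < ε → ∃ μ ∈ EplusOn κ A, strDist κ ν μ < ε}

/-- The (real-valued) potential of the signed measure `λ = lp − lm`. -/
noncomputable def spot (κ : X → X → ℝ≥0∞) (lp lm : Measure X) (x : X) : ℝ :=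
  (pot κ lp x).toReal - (pot κ lm x).toReal

/-- Assumption (A2): every `f ∈ C_c(X)` is the limit, uniformly with supports in one fixed
compact set, of a sequence of potentials of signed measures of finite energy that are
continuous and compactly supported. -/
def A2 (κ : X → X → ℝ≥0∞) : Prop :=
  ∀ f : X → ℝ, Continuous f → HasCompactSupport f →
    ∃ (K : Set X) (lp lm : ℕ → Measure X), IsCompact K ∧ tsupport f ⊆ K ∧
      (∀ j, lp j ∈ Eplus κ ∧ lm j ∈ Eplus κ) ∧
      (∀ j x, pot κ (lp j) x ≠ ⊤ ∨ pot κ (lm j) x ≠ ⊤) ∧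
      (∀ j, Continuous (spot κ (lp j) (lm j))) ∧
      (∀ j, tsupport (spot κ (lp j) (lm j)) ⊆ K) ∧
      TendstoUniformly (fun j => spot κ (lp j) (lm j)) f atTop

set_option linter.unusedSectionVars false

section Directed

variable {Y : Type*} [TopologicalSpace Y]

/-- **τ-additivity**: the integral against an inner regular measure commutes with suprema of
directed families of lower semicontinuous functions. -/
theorem lintegral_iSup_directed_of_lowerSemicontinuous [MeasurableSpace Y] [BorelSpace Y]
    (m : Measure Y) [m.InnerRegular] {ι : Type*} [Nonempty ι] {f : ι → Y → ℝ≥0∞}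
    (hf : ∀ i, LowerSemicontinuous (f i)) (hdir : Directed (· ≤ ·) f) :
    ∫⁻ y, ⨆ i, f i y ∂m = ⨆ i, ∫⁻ y, f i y ∂m := by
  have hle : (⨆ i, ∫⁻ y, f i y ∂m) ≤ ∫⁻ y, ⨆ i, f i y ∂m :=
    iSup_le fun i => lintegral_mono fun y => le_iSup (fun i => f i y) i
  refine le_antisymm ?_ hle
  rcases eq_or_ne (⨆ i, ∫⁻ y, f i y ∂m) ⊤ with hS | hS
  · rw [hS]; exact le_top
  obtain ⟨u, -, hu, hmem⟩ := exists_seq_tendsto_sSup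
    (Set.range_nonempty fun i => ∫⁻ y, f i y ∂m) (OrderTop.bddAbove _)
  choose s hs using hmem
  have hmeas : ∀ i, Measurable (f i) := fun i => (hf i).measurable
  set G : Y → ℝ≥0∞ := fun y => ⨆ n, f (s n) y with hG
  have hGmeas : Measurable G := Measurable.iSup fun n => hmeas _
  have hSG : (⨆ i, ∫⁻ y, f i y ∂m) ≤ ∫⁻ y, G y ∂m := by
    refine le_of_tendsto' hu fun n => ?_
    rw [← hs n]
    exact lintegral_mono fun y => le_iSup (fun n => f (s n) y) n
  have hmax : ∀ i, ∫⁻ y, f i y ⊔ G y ∂m ≤ ⨆ i, ∫⁻ y, f i y ∂m := by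
    intro i
    choose c hc using hdir
    let j : ℕ → ι := fun n => Nat.rec (c i (s 0)) (fun n k => c k (s (n + 1))) n
    have hj : ∀ n, f (j n) ≤ f (j (n + 1)) := fun n => (hc _ _).1
    have hmono : Monotone fun n => f (j n) := monotone_nat_of_le_succ hj
    have hi : f i ≤ f (j 0) := (hc _ _).1
    have hsj : ∀ n, f (s n) ≤ f (j n) := by
      intro n
      cases n with
      | zero => exact (hc _ _).2
      | succ n => exact (hc _ _).2
    calc ∫⁻ y, f i y ⊔ G y ∂m ≤ ∫⁻ y, ⨆ n, f (j n) y ∂m := by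
          refine lintegral_mono fun y => sup_le ((hi y).trans (le_iSup (fun n => f (j n) y) 0)) ?_
          exact iSup_mono fun n => hsj n y
      _ = ⨆ n, ∫⁻ y, f (j n) y ∂m := lintegral_iSup (fun n => hmeas _) hmono
      _ ≤ _ := iSup_le fun n => le_iSup (fun i => ∫⁻ y, f i y ∂m) (j n)
  have hGle : ∫⁻ y, G y ∂m ≤ ⨆ i, ∫⁻ y, f i y ∂m :=
    (lintegral_mono fun y => le_sup_right).trans (hmax (Classical.arbitrary ι))
  have hnull : ∀ i, m {y | G y < f i y} = 0 := by
    intro i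
    have h := ae_eq_of_ae_le_of_lintegral_le (μ := m) (f := G) (g := fun y => f i y ⊔ G y)
      (Eventually.of_forall fun y => le_sup_right) (ne_top_of_le_ne_top hS hGle)
      ((hmeas i).sup hGmeas).aemeasurable ((hmax i).trans hSG)
    refine measure_mono_null (fun y hy => ?_) (ae_iff.1 h)
    intro h'
    have : f i y ≤ G y := by rw [h']; exact le_sup_left
    exact absurd hy (not_lt.2 this)
  have hFmeas : Measurable fun y => ⨆ i, f i y := (lowerSemicontinuous_iSup hf).measurable
  have hae : ∀ᵐ y ∂m, (⨆ i, f i y) ≤ G y := by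
    rw [ae_iff]
    have hsub : {y | ¬ (⨆ i, f i y) ≤ G y} ⊆ ⋃ q : ℚ, {y | G y < (Real.toNNReal q : ℝ≥0∞)} ∩
        {y | (Real.toNNReal q : ℝ≥0∞) < ⨆ i, f i y} := by
      intro y hy
      obtain ⟨q, -, h1, h2⟩ := ENNReal.lt_iff_exists_rat_btwn.1 (not_le.1 hy)
      exact Set.mem_iUnion.2 ⟨q, h1, h2⟩
    refine measure_mono_null hsub (measure_iUnion_null fun q => ?_)
    set p : ℝ≥0∞ := (Real.toNNReal q : ℝ≥0∞)
    have hN : MeasurableSet ({y | G y < p} ∩ {y | p < ⨆ i, f i y}) :=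
      (measurableSet_lt hGmeas measurable_const).inter (measurableSet_lt measurable_const hFmeas)
    by_contra hpos
    obtain ⟨K, hKN, hK, hKpos⟩ := hN.exists_lt_isCompact (pos_iff_ne_zero.2 hpos)
    obtain ⟨i, hi⟩ := hK.elim_directed_cover (fun i => {y | p < f i y})
      (fun i => (hf i).isOpen_preimage p) (fun y hy => by
        have hy2 : p < ⨆ i, f i y := (hKN hy).2
        obtain ⟨i, hi⟩ := lt_iSup_iff.1 hy2
        exact Set.mem_iUnion.2 ⟨i, hi⟩)
      (fun i j => by
        obtain ⟨k, h1, h2⟩ := hdir i j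
        exact ⟨k, fun y hy => lt_of_lt_of_le hy (h1 y), fun y hy => lt_of_lt_of_le hy (h2 y)⟩)
    refine hKpos.ne' (measure_mono_null (fun y hy => ?_) (hnull i))
    have h1 : G y < p := (hKN hy).1
    have h2 : p < f i y := hi hy
    exact h1.trans h2
  exact (lintegral_mono_ae hae).trans hGle

/-- The nonnegative continuous compactly supported minorants of `g`. -/
abbrev CcMinorant (g : Y → ℝ≥0∞) : Type _ :=
  {φ : Y → ℝ // Continuous φ ∧ HasCompactSupport φ ∧ (∀ y, 0 ≤ φ y) ∧
    ∀ y, ENNReal.ofReal (φ y) ≤ g y}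

instance (g : Y → ℝ≥0∞) : Nonempty (CcMinorant g) :=
  ⟨⟨fun _ => 0, continuous_const, HasCompactSupport.zero, fun _ => le_rfl, fun _ => by simp⟩⟩

theorem directed_ccMinorant (g : Y → ℝ≥0∞) :
    Directed (· ≤ ·) fun (φ : CcMinorant g) y => ENNReal.ofReal (φ.1 y) := by
  rintro ⟨φ, h1, h2, h3, h4⟩ ⟨ψ, k1, k2, k3, k4⟩
  refine ⟨⟨fun y => φ y ⊔ ψ y, h1.sup k1, ?_, fun y => (h3 y).trans le_sup_left, fun y => ?_⟩,
    fun y => ENNReal.ofReal_le_ofReal le_sup_left, fun y => ENNReal.ofReal_le_ofReal le_sup_right⟩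
  · exact h2.comp₂_left k2 (by simp)
  · rcases le_total (φ y) (ψ y) with h | h
    · simpa [h] using k4 y
    · simpa [h] using h4 y

theorem iSup_ccMinorant [T2Space Y] [LocallyCompactSpace Y] {g : Y → ℝ≥0∞}
    (hg : LowerSemicontinuous g) (y : Y) :
    ⨆ φ : CcMinorant g, ENNReal.ofReal (φ.1 y) = g y := by
  refine le_antisymm (iSup_le fun φ => φ.2.2.2.2 y) (le_of_forall_lt fun a ha => ?_)
  obtain ⟨c, hac, hcg⟩ := ENNReal.lt_iff_exists_nnreal_btwn.1 ha
  obtain ⟨u, hu1, hu0, huc, hu⟩ := exists_continuous_one_zero_of_isCompact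
    (isCompact_singleton (x := y)) (hg.isOpen_preimage c).isClosed_compl
    (Set.disjoint_singleton_left.2 fun h => h hcg)
  refine lt_of_lt_of_le hac (le_trans ?_ (le_iSup (fun φ : CcMinorant g =>
    ENNReal.ofReal (φ.1 y)) ⟨fun z => c * u z, by fun_prop, huc.mul_left, fun z =>
      mul_nonneg c.2 (hu z).1, fun z => ?_⟩))
  · simp [hu1 (Set.mem_singleton y)]
  · by_cases hz : (c : ℝ≥0∞) < g z
    · refine le_trans ?_ hz.le
      rw [← ENNReal.ofReal_coe_nnreal]
      exact ENNReal.ofReal_le_ofReal (mul_le_of_le_one_right c.2 (hu z).2)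
    · have : u z = 0 := hu0 hz
      simp [this]

theorem lintegral_ofReal_ccMinorant [MeasurableSpace Y] [OpensMeasurableSpace Y] (m : Measure Y)
    [IsFiniteMeasureOnCompacts m] {φ : Y → ℝ} (hφ : Continuous φ) (hc : HasCompactSupport φ)
    (h0 : ∀ y, 0 ≤ φ y) : ∫⁻ y, ENNReal.ofReal (φ y) ∂m = ENNReal.ofReal (∫ y, φ y ∂m) :=
  (ofReal_integral_eq_lintegral_ofReal (hφ.integrable_of_hasCompactSupport hc)
    (Eventually.of_forall h0)).symm

theorem continuous_ofReal_ccMinorant {g : Y → ℝ≥0∞} (φ : CcMinorant g) :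
    Continuous fun y => ENNReal.ofReal (φ.1 y) :=
  ENNReal.continuous_ofReal.comp φ.2.1

theorem lintegral_eq_iSup_ccMinorant [T2Space Y] [LocallyCompactSpace Y] [MeasurableSpace Y]
    [BorelSpace Y] (m : Measure Y) [m.InnerRegular] {g : Y → ℝ≥0∞}
    (hg : LowerSemicontinuous g) :
    ∫⁻ y, g y ∂m = ⨆ φ : CcMinorant g, ∫⁻ y, ENNReal.ofReal (φ.1 y) ∂m := by
  rw [← lintegral_iSup_directed_of_lowerSemicontinuous m
    (fun φ => (continuous_ofReal_ccMinorant φ).lowerSemicontinuous) (directed_ccMinorant g)]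
  simp_rw [iSup_ccMinorant hg]

theorem lowerSemicontinuous_slice {κ : Y → Y → ℝ≥0∞}
    (hκ : LowerSemicontinuous (Function.uncurry κ)) (x : Y) : LowerSemicontinuous (κ x) :=
  hκ.comp (Continuous.prodMk_right x)

theorem hasCompactSupport_slice [T2Space Y] {φ : Y × Y → ℝ} (hc : HasCompactSupport φ) (x : Y) :
    HasCompactSupport fun y => φ (x, y) :=
  HasCompactSupport.intro (hc.isCompact.image continuous_snd) fun y hy => by
    by_contra h
    exact hy ⟨(x, y), subset_tsupport _ h, rfl⟩

theorem continuous_integral_slice [MeasurableSpace Y] [OpensMeasurableSpace Y] {φ : Y × Y → ℝ}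
    (hφ : Continuous φ) (hc : HasCompactSupport φ) (m : Measure Y) [IsLocallyFiniteMeasure m] :
    Continuous fun x => ∫ y, φ (x, y) ∂m := by
  rw [← continuousOn_univ]
  refine continuousOn_integral_of_compact_support (k := Prod.snd '' tsupport φ)
    (hc.isCompact.image continuous_snd) (f := fun x y => φ (x, y)) hφ.continuousOn ?_
  intro x y _ hy
  by_contra h
  exact hy ⟨(x, y), subset_tsupport _ h, rfl⟩

end Directed
section Kernel

variable {κ : X → X → ℝ≥0∞}

theorem pot_eq_iSup (hker : IsKernel κ) {m : Measure X} (hm : IsRadon m) (x : X) :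
    pot κ m x = ⨆ φ : CcMinorant (Function.uncurry κ), ENNReal.ofReal (∫ y, φ.1 (x, y) ∂m) := by
  have := hm.1
  have := hm.2
  calc pot κ m x = ∫⁻ y, ⨆ φ : CcMinorant (Function.uncurry κ), ENNReal.ofReal (φ.1 (x, y)) ∂m := by
        simp_rw [iSup_ccMinorant hker.lsc]; rfl
    _ = ⨆ φ : CcMinorant (Function.uncurry κ), ∫⁻ y, ENNReal.ofReal (φ.1 (x, y)) ∂m := by
        refine lintegral_iSup_directed_of_lowerSemicontinuous m (fun φ => ?_) ?_
        · exact ((continuous_ofReal_ccMinorant φ).comp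
            (Continuous.prodMk_right x)).lowerSemicontinuous
        · intro φ ψ
          obtain ⟨θ, h1, h2⟩ := directed_ccMinorant (Function.uncurry κ) φ ψ
          exact ⟨θ, fun y => h1 (x, y), fun y => h2 (x, y)⟩
    _ = _ := by
        congr with φ
        exact lintegral_ofReal_ccMinorant m (φ.2.1.comp (Continuous.prodMk_right x))
          (hasCompactSupport_slice φ.2.2.1 x) fun y => φ.2.2.2.1 _

theorem lsc_pot (hker : IsKernel κ) {m : Measure X} (hm : IsRadon m) :
    LowerSemicontinuous (pot κ m) := by
  have := hm.2
  have h : pot κ m = fun x => ⨆ φ : CcMinorant (Function.uncurry κ),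
      ENNReal.ofReal (∫ y, φ.1 (x, y) ∂m) := funext (pot_eq_iSup hker hm)
  rw [h]
  exact lowerSemicontinuous_iSup fun φ => (ENNReal.continuous_ofReal.comp
    (continuous_integral_slice φ.2.1 φ.2.2.1 m)).lowerSemicontinuous

theorem measurable_pot (hker : IsKernel κ) {m : Measure X} (hm : IsRadon m) :
    Measurable (pot κ m) :=
  (lsc_pot hker hm).measurable

theorem lintegral_pot_eq_iSup (hker : IsKernel κ) {m n : Measure X} (hm : IsRadon m)
    (hn : IsRadon n) : energy κ m n =
      ⨆ φ : CcMinorant (Function.uncurry κ), ENNReal.ofReal (∫ x, ∫ y, φ.1 (x, y) ∂n ∂m) := by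
  have := hm.1
  have := hm.2
  have := hn.2
  unfold energy
  simp_rw [pot_eq_iSup hker hn]
  rw [lintegral_iSup_directed_of_lowerSemicontinuous m]
  · congr with φ
    refine lintegral_ofReal_ccMinorant m (continuous_integral_slice φ.2.1 φ.2.2.1 n) ?_
      fun x => integral_nonneg fun y => φ.2.2.2.1 _
    refine HasCompactSupport.intro (φ.2.2.1.isCompact.image continuous_fst) fun x hx => ?_
    have : ∀ y, φ.1 (x, y) = 0 := fun y => by
      by_contra h
      exact hx ⟨(x, y), subset_tsupport _ h, rfl⟩
    simp [this]
  · exact fun φ => (ENNReal.continuous_ofReal.comp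
      (continuous_integral_slice φ.2.1 φ.2.2.1 n)).lowerSemicontinuous
  · have hslice : ∀ (φ : CcMinorant (Function.uncurry κ)) x, Integrable (fun y => φ.1 (x, y)) n :=
      fun φ x => (φ.2.1.comp (Continuous.prodMk_right x)).integrable_of_hasCompactSupport
        (hasCompactSupport_slice φ.2.2.1 x)
    intro φ ψ
    obtain ⟨θ, h1, h2⟩ := directed_ccMinorant (Function.uncurry κ) φ ψ
    refine ⟨θ, fun x => ENNReal.ofReal_le_ofReal (integral_mono (hslice _ _) (hslice _ _) fun y => ?_),
      fun x => ENNReal.ofReal_le_ofReal (integral_mono (hslice _ _) (hslice _ _) fun y => ?_)⟩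
    · exact (ENNReal.ofReal_le_ofReal_iff (θ.2.2.2.1 _)).1 (h1 (x, y))
    · exact (ENNReal.ofReal_le_ofReal_iff (θ.2.2.2.1 _)).1 (h2 (x, y))

theorem energy_comm (hker : IsKernel κ) {m n : Measure X} (hm : IsRadon m) (hn : IsRadon n) :
    energy κ m n = energy κ n m := by
  have := hm.2
  have := hn.2
  rw [lintegral_pot_eq_iSup hker hm hn, lintegral_pot_eq_iSup hker hn hm]
  have swap : ∀ φ : CcMinorant (Function.uncurry κ), ∃ ψ : CcMinorant (Function.uncurry κ),
      ∀ x y, ψ.1 (x, y) = φ.1 (y, x) := by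
    rintro ⟨φ, h1, h2, h3, h4⟩
    refine ⟨⟨φ ∘ Prod.swap, h1.comp continuous_swap,
      h2.comp_homeomorph (Homeomorph.prodComm X X), fun z => h3 _, ?_⟩, fun x y => rfl⟩
    rintro ⟨x, y⟩
    simpa [Function.uncurry, hker.symm x y] using h4 (y, x)
  have key : ∀ (m n : Measure X) [IsLocallyFiniteMeasure m] [IsLocallyFiniteMeasure n],
      (⨆ φ : CcMinorant (Function.uncurry κ), ENNReal.ofReal (∫ x, ∫ y, φ.1 (x, y) ∂n ∂m)) ≤
      ⨆ φ : CcMinorant (Function.uncurry κ), ENNReal.ofReal (∫ x, ∫ y, φ.1 (x, y) ∂m ∂n) := by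
    intro m n _ _
    refine iSup_le fun φ => ?_
    obtain ⟨ψ, hψ⟩ := swap φ
    refine le_trans (le_of_eq ?_) (le_iSup (fun φ : CcMinorant (Function.uncurry κ) =>
      ENNReal.ofReal (∫ x, ∫ y, φ.1 (x, y) ∂m ∂n)) ψ)
    simp_rw [hψ]
    rw [integral_integral_swap_of_hasCompactSupport (f := fun x y => φ.1 (x, y)) φ.2.1 φ.2.2.1]
  exact le_antisymm (key m n) (key n m)

/-- The potential of a vague limit is bounded by any common bound of the potentials. -/
theorem pot_le_of_vagueConv (hker : IsKernel κ) {ι : Type*} {F : Filter ι} [F.NeBot]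
    {m : ι → Measure X} (hm : ∀ i, IsRadon (m i)) {ν : Measure X} (hν : IsRadon ν)
    (hconv : VagueConv F m ν) {x : X} {c : ℝ≥0∞} (hc : ∀ i, pot κ (m i) x ≤ c) :
    pot κ ν x ≤ c := by
  have := hν.1
  have := hν.2
  rw [pot, lintegral_eq_iSup_ccMinorant ν (lowerSemicontinuous_slice hker.lsc x)]
  refine iSup_le fun φ => ?_
  rw [lintegral_ofReal_ccMinorant ν φ.2.1 φ.2.2.1 φ.2.2.2.1]
  refine le_of_tendsto' ((ENNReal.continuous_ofReal.tendsto _).comp (hconv φ.1 φ.2.1 φ.2.2.1))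
    fun i => le_trans ?_ (hc i)
  have := (hm i).2
  rw [Function.comp_apply, ← lintegral_ofReal_ccMinorant (m i) φ.2.1 φ.2.2.1 φ.2.2.2.1]
  exact lintegral_mono φ.2.2.2.2

end Kernel
section VagueCompactness

/-- A regular measure and an inner regular one, locally finite, have the same integrals of
continuous compactly supported functions. -/
theorem exists_isRadon_integral_eq (m : Measure X) [m.Regular] :
    ∃ ν : Measure X, IsRadon ν ∧ ∀ f : X → ℝ, HasCompactSupport f →
      ∫ x, f x ∂ν = ∫ x, f x ∂m := by
  let ν : Measure X := Measure.ofMeasurable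
    (fun s _ => ⨆ K : TopologicalSpace.Compacts X, m (s ∩ K)) (by simp) (by
      intro s hs hd
      have h : ∀ K : TopologicalSpace.Compacts X, m ((⋃ i, s i) ∩ K) = ∑' i, m (s i ∩ K) := by
        intro K
        rw [Set.iUnion_inter, measure_iUnion]
        · exact fun i j hij => (hd hij).mono Set.inter_subset_left Set.inter_subset_left
        · exact fun i => (hs i).inter K.isCompact.measurableSet
      simp_rw [h, ENNReal.tsum_eq_iSup_sum]
      rw [iSup_comm]
      congr with t
      rw [ENNReal.finsetSum_iSup_of_monotone]
      intro i K L hKL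
      exact measure_mono (Set.inter_subset_inter_right _ hKL))
  have hν : ∀ s, MeasurableSet s → ν s = ⨆ K : TopologicalSpace.Compacts X, m (s ∩ K) :=
    fun s hs => Measure.ofMeasurable_apply s hs
  have hνK : ∀ s K, MeasurableSet s → IsCompact K → ν (s ∩ K) = m (s ∩ K) := by
    intro s K hs hK
    rw [hν _ (hs.inter hK.measurableSet)]
    refine le_antisymm (iSup_le fun L => measure_mono Set.inter_subset_left) ?_
    refine le_trans (le_of_eq ?_) (le_iSup (fun L : TopologicalSpace.Compacts X =>
      m (s ∩ K ∩ L)) ⟨K, hK⟩)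
    simp [Set.inter_assoc]
  have hνK' : ∀ K, IsCompact K → ν K = m K := fun K hK => by
    simpa using hνK Set.univ K MeasurableSet.univ hK
  refine ⟨ν, ⟨⟨?_⟩, ⟨?_⟩⟩, ?_⟩
  · intro s hs r hr
    rw [hν s hs] at hr
    obtain ⟨K, hK⟩ := lt_iSup_iff.1 hr
    obtain ⟨L, hLs, hL, hrL⟩ := (hs.inter K.isCompact.measurableSet).exists_lt_isCompact_of_ne_top
      ((measure_mono Set.inter_subset_right).trans_lt K.isCompact.measure_lt_top).ne hK
    exact ⟨L, hLs.trans Set.inter_subset_left, hL, by rwa [hνK' L hL]⟩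
  · intro x
    obtain ⟨K, hK, hx⟩ := exists_compact_mem_nhds x
    exact ⟨K, hx, by rw [hνK' K hK]; exact hK.measure_lt_top⟩
  · intro f hf
    have h0 : ∀ x, x ∉ tsupport f → f x = 0 := fun x hx => image_eq_zero_of_notMem_tsupport hx
    have hr : ν.restrict (tsupport f) = m.restrict (tsupport f) := by
      ext s hs
      rw [Measure.restrict_apply hs, Measure.restrict_apply hs, hνK s _ hs hf.isCompact]
    rw [← setIntegral_eq_integral_of_forall_compl_eq_zero h0, hr,
      setIntegral_eq_integral_of_forall_compl_eq_zero h0]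

open CompactlySupported in
/-- **Vague compactness**: a family of Radon measures bounded on compact sets has a vague limit
along every ultrafilter. -/
theorem exists_vagueConv_ultrafilter {ι : Type*} (U : Ultrafilter ι) {m : ι → Measure X}
    (hm : ∀ i, IsRadon (m i))
    (hbd : ∀ K, IsCompact K → ∃ C : ℝ≥0, ∀ i, m i K ≤ C) :
    ∃ ν : Measure X, IsRadon ν ∧ VagueConv (U : Filter ι) m ν := by
  have hloc : ∀ i, IsLocallyFiniteMeasure (m i) := fun i => (hm i).2
  have hlim : ∀ f : C_c(X, ℝ), ∃ l : ℝ, Tendsto (fun i => ∫ x, f x ∂(m i)) U (𝓝 l) := by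
    intro f
    have hf : HasCompactSupport f := f.hasCompactSupport
    obtain ⟨C, hC⟩ := hbd _ hf.isCompact
    obtain ⟨M, hM⟩ := hf.exists_bound_of_continuous f.continuous
    have hb : ∀ i, ∫ x, f x ∂(m i) ∈ Set.Icc (-(|M| * C)) (|M| * C) := by
      intro i
      rw [Set.mem_Icc, ← abs_le, ← Real.norm_eq_abs, ← setIntegral_eq_integral_of_forall_compl_eq_zero
        (s := tsupport f) fun x hx => image_eq_zero_of_notMem_tsupport hx]
      refine (norm_setIntegral_le_of_norm_le_const hf.isCompact.measure_lt_top
        fun x _ => (hM x).trans (le_abs_self M)).trans ?_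
      refine mul_le_mul_of_nonneg_left ?_ (abs_nonneg M)
      exact ENNReal.toReal_le_coe_of_le_coe (hC i)
    obtain ⟨l, -, hl⟩ := isCompact_Icc.ultrafilter_le_nhds
      (U.map fun i => ∫ x, f x ∂(m i)) (by
        rw [le_principal_iff, Ultrafilter.coe_map]
        exact Filter.mem_map.2 (Filter.univ_mem' hb))
    exact ⟨l, hl⟩
  choose l hl using hlim
  have hinteg : ∀ (f : C_c(X, ℝ)) i, Integrable f (m i) := fun f i =>
    f.continuous.integrable_of_hasCompactSupport f.hasCompactSupport
  let Λ₀ : C_c(X, ℝ) →ₗ[ℝ] ℝ :=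
    { toFun := l
      map_add' := fun f g => by
        refine tendsto_nhds_unique (hl (f + g)) (((hl f).add (hl g)).congr fun i => ?_)
        rw [← integral_add (hinteg f i) (hinteg g i)]
        rfl
      map_smul' := fun c f => by
        refine tendsto_nhds_unique (hl (c • f)) (((hl f).const_mul c).congr fun i => ?_)
        rw [← integral_const_mul]
        rfl }
  let Λ : C_c(X, ℝ) →ₚ[ℝ] ℝ := PositiveLinearMap.mk₀ Λ₀ fun f hf =>
    ge_of_tendsto' (hl f) fun i => integral_nonneg fun x => hf x
  obtain ⟨ν, hν, hνf⟩ := exists_isRadon_integral_eq (RealRMK.rieszMeasure Λ)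
  refine ⟨ν, hν, fun f hf hc => ?_⟩
  have h := RealRMK.integral_rieszMeasure Λ ⟨⟨f, hf⟩, hc⟩
  have h2 : ∫ x, f x ∂ν = l ⟨⟨f, hf⟩, hc⟩ := (hνf f hc).trans h
  rw [h2]
  exact hl ⟨⟨f, hf⟩, hc⟩

end VagueCompactness

section Energy

variable {κ : X → X → ℝ≥0∞}

theorem EnergyPrinciple.diag_pos (hE : EnergyPrinciple κ) (x : X) : 0 < κ x x := by
  rw [pos_iff_ne_zero]
  intro h
  have hrad : IsRadon (Measure.dirac x) := by
    refine ⟨⟨fun s hs r hr => ?_⟩, inferInstance⟩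
    by_cases hx : x ∈ s
    · refine ⟨{x}, Set.singleton_subset_iff.2 hx, isCompact_singleton, ?_⟩
      rw [Measure.dirac_apply_of_mem hx] at hr
      rwa [Measure.dirac_apply_of_mem (Set.mem_singleton x)]
    · rw [Measure.dirac_apply' _ hs, Set.indicator_of_notMem hx] at hr
      exact absurd hr not_lt_zero
  have he : energy κ (Measure.dirac x) (Measure.dirac x) = 0 := by
    simp [energy, pot, lintegral_dirac, h]
  have h0 := (hE _ ⟨hrad, by rw [he]; exact ENNReal.zero_lt_top⟩ 0
    ⟨⟨inferInstance, inferInstance⟩, by simp [energy]⟩).2 (by rw [he]; simp [energy, pot])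
  exact NeZero.ne (Measure.dirac x) h0

/-- Bounded energy implies boundedness on compact sets. -/
theorem exists_measure_le_of_energy_le (hker : IsKernel κ) (hE : EnergyPrinciple κ) {C : ℝ≥0∞}
    (hC : C ≠ ⊤) {K : Set X} (hK : IsCompact K) :
    ∃ D : ℝ≥0, ∀ m : Measure X, energy κ m m ≤ C → m K ≤ D := by
  refine hK.induction_on (p := fun s => ∃ D : ℝ≥0, ∀ m : Measure X, energy κ m m ≤ C → m s ≤ D)
    ⟨0, fun m _ => by simp⟩ ?_ ?_ ?_
  · rintro s t hst ⟨D, hD⟩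
    exact ⟨D, fun m hm => (measure_mono hst).trans (hD m hm)⟩
  · rintro s t ⟨D, hD⟩ ⟨D', hD'⟩
    refine ⟨D + D', fun m hm => (measure_union_le s t).trans ?_⟩
    push_cast
    exact add_le_add (hD m hm) (hD' m hm)
  · intro x _
    obtain ⟨c, hc0, hc⟩ := ENNReal.lt_iff_exists_nnreal_btwn.1 (hE.diag_pos x)
    have hmem : {p : X × X | (c : ℝ≥0∞) < Function.uncurry κ p} ∈ 𝓝 (x, x) :=
      (hker.lsc.isOpen_preimage c).mem_nhds hc
    rw [nhds_prod_eq, Filter.mem_prod_same_iff] at hmem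
    obtain ⟨V, hV, hVc⟩ := hmem
    refine ⟨interior V, mem_nhdsWithin_of_mem_nhds (interior_mem_nhds.2 hV),
      (max 1 (C / c)).toNNReal, fun m hm => ?_⟩
    have hfin : max 1 (C / c) ≠ ⊤ := by
      have : C / c ≠ ⊤ := ENNReal.div_ne_top hC hc0.ne'
      simp [max_eq_top, this]
    rw [ENNReal.coe_toNNReal hfin]
    have hmeas : MeasurableSet (interior V) := isOpen_interior.measurableSet
    have hpot : ∀ y ∈ interior V, (c : ℝ≥0∞) * m (interior V) ≤ pot κ m y := fun y hy => by
      rw [← setLIntegral_const]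
      refine (setLIntegral_mono' hmeas fun z hz => ?_).trans (setLIntegral_le_lintegral _ _)
      exact (hVc (Set.mk_mem_prod (interior_subset hy) (interior_subset hz))).le
    have hen : (c : ℝ≥0∞) * m (interior V) * m (interior V) ≤ C := by
      rw [← setLIntegral_const]
      exact ((setLIntegral_mono' hmeas hpot).trans (setLIntegral_le_lintegral _ _)).trans hm
    rcases le_total (m (interior V)) 1 with h1 | h1
    · exact h1.trans (le_max_left _ _)
    · refine le_trans ?_ (le_max_right _ _)
      rw [ENNReal.le_div_iff_mul_le (Or.inl hc0.ne') (Or.inl ENNReal.coe_ne_top), mul_comm]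
      exact (le_mul_of_one_le_right' h1).trans hen

theorem IsRadon.add {μ ν : Measure X} (hμ : IsRadon μ) (hν : IsRadon ν) : IsRadon (μ + ν) := by
  have := hμ.1
  have := hν.1
  have := hμ.2
  have := hν.2
  refine ⟨inferInstance, ⟨fun x => ?_⟩⟩
  obtain ⟨K, hK, hx⟩ := exists_compact_mem_nhds x
  exact ⟨K, hx, by simpa using ⟨hK.measure_lt_top, hK.measure_lt_top⟩⟩

theorem IsRadon.smul {μ : Measure X} (hμ : IsRadon μ) {c : ℝ≥0∞} (hc : c ≠ ⊤) :
    IsRadon (c • μ) := by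
  have := hμ.1
  have := hμ.2
  refine ⟨inferInstance, ⟨fun x => ?_⟩⟩
  obtain ⟨K, hK, hx⟩ := exists_compact_mem_nhds x
  exact ⟨K, hx, by simpa using ENNReal.mul_lt_top hc.lt_top hK.measure_lt_top⟩

theorem energy_add_left (μ ν ρ : Measure X) :
    energy κ (μ + ν) ρ = energy κ μ ρ + energy κ ν ρ :=
  lintegral_add_measure _ _ _

theorem energy_smul_left (c : ℝ≥0∞) (μ ρ : Measure X) :
    energy κ (c • μ) ρ = c * energy κ μ ρ := by
  simp [energy, lintegral_smul_measure]

theorem energy_mono_right {ρ μ ν : Measure X} (h : ∀ x, pot κ μ x ≤ pot κ ν x) :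
    energy κ ρ μ ≤ energy κ ρ ν :=
  lintegral_mono h

theorem energy_self_mono (hker : IsKernel κ) {μ ν : Measure X} (hμ : IsRadon μ) (hν : IsRadon ν)
    (h : ∀ x, pot κ μ x ≤ pot κ ν x) : energy κ μ μ ≤ energy κ ν ν :=
  (energy_mono_right h).trans ((energy_comm hker hμ hν).le.trans (energy_mono_right h))

theorem EnergyPrinciple.energy_ne_top (hE : EnergyPrinciple κ) {μ ν : Measure X}
    (hμ : μ ∈ Eplus κ) (hν : ν ∈ Eplus κ) : energy κ μ ν ≠ ⊤ := by
  intro h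
  have h1 := (hE μ hμ ν hν).1
  rw [h, ENNReal.mul_top (by norm_num), top_le_iff] at h1
  exact (ENNReal.add_lt_top.2 ⟨hμ.2, hν.2⟩).ne h1

/-- The square of the energy distance. -/
noncomputable def strDistSq (κ : X → X → ℝ≥0∞) (μ ν : Measure X) : ℝ :=
  (energy κ μ μ).toReal - 2 * (energy κ μ ν).toReal + (energy κ ν ν).toReal

theorem EnergyPrinciple.strDistSq_nonneg (hE : EnergyPrinciple κ) {μ ν : Measure X}
    (hμ : μ ∈ Eplus κ) (hν : ν ∈ Eplus κ) : 0 ≤ strDistSq κ μ ν := by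
  have h := ENNReal.toReal_mono (ENNReal.add_lt_top.2 ⟨hμ.2, hν.2⟩).ne (hE μ hμ ν hν).1
  rw [ENNReal.toReal_mul, ENNReal.toReal_add hμ.2.ne hν.2.ne, ENNReal.toReal_ofNat] at h
  unfold strDistSq
  linarith

theorem strDistSq_comm (hker : IsKernel κ) {μ ν : Measure X} (hμ : IsRadon μ) (hν : IsRadon ν) :
    strDistSq κ μ ν = strDistSq κ ν μ := by
  unfold strDistSq
  rw [energy_comm hker hμ hν]
  ring

theorem strDistSq_le_of_pot_le (hE : EnergyPrinciple κ) {μ ν : Measure X}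
    (hμ : μ ∈ Eplus κ) (hν : ν ∈ Eplus κ) (h : ∀ x, pot κ μ x ≤ pot κ ν x) :
    strDistSq κ μ ν ≤ (energy κ ν ν).toReal - (energy κ μ μ).toReal := by
  have := ENNReal.toReal_mono (hE.energy_ne_top hμ hν) (energy_mono_right (ρ := μ) h)
  unfold strDistSq
  linarith

/-- Two measures of finite energy with the same potential coincide. -/
theorem EnergyPrinciple.eq_of_pot_eq (hE : EnergyPrinciple κ) (hker : IsKernel κ)
    {μ ν : Measure X} (hμ : μ ∈ Eplus κ) (hν : ν ∈ Eplus κ) (h : ∀ x, pot κ μ x = pot κ ν x) :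
    μ = ν := by
  have hp : pot κ μ = pot κ ν := funext h
  refine (hE μ hμ ν hν).2 ?_
  have h1 : energy κ μ μ = energy κ μ ν := by unfold energy; rw [hp]
  have h2 : energy κ ν ν = energy κ μ ν := by
    rw [energy_comm hker hμ.1 hν.1]; unfold energy; rw [hp]
  rw [h1, h2, two_mul]

/-- The form of the Cauchy–Schwarz inequality provided by the energy principle. -/
theorem two_mul_energy_sub_le (hker : IsKernel κ) (hE : EnergyPrinciple κ) {α π ν : Measure X}
    (hα : α ∈ Eplus κ) (hπ : π ∈ Eplus κ) (hν : ν ∈ Eplus κ) (t : ℝ≥0) :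
    2 * t * ((energy κ α π).toReal - (energy κ α ν).toReal) ≤
      t ^ 2 * (energy κ α α).toReal + strDistSq κ π ν := by
  have ht : (t : ℝ≥0∞) ≠ ⊤ := ENNReal.coe_ne_top
  have hrad : IsRadon ((t : ℝ≥0∞) • α + ν) := (hα.1.smul ht).add hν.1
  have e1 : energy κ ((t : ℝ≥0∞) • α + ν) π = t * energy κ α π + energy κ ν π := by
    rw [energy_add_left, energy_smul_left]
  have e2 : energy κ ((t : ℝ≥0∞) • α + ν) ((t : ℝ≥0∞) • α + ν) =
      t * (t * energy κ α α + energy κ α ν) + (t * energy κ α ν + energy κ ν ν) := by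
    rw [energy_add_left, energy_smul_left, energy_comm hker hα.1 hrad, energy_comm hker hν.1 hrad,
      energy_add_left, energy_add_left, energy_smul_left, energy_smul_left,
      energy_comm hker hν.1 hα.1]
  have f1 := hE.energy_ne_top hα hπ
  have f2 := hE.energy_ne_top hν hπ
  have f3 := hE.energy_ne_top hα hν
  have f4 := hα.2.ne
  have f5 := hν.2.ne
  have hmem : (t : ℝ≥0∞) • α + ν ∈ Eplus κ := by
    refine ⟨hrad, ?_⟩
    rw [e2, lt_top_iff_ne_top]
    finiteness
  have h := hE.strDistSq_nonneg hmem hπ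
  rw [strDistSq, e1, e2, energy_comm hker hν.1 hπ.1,
    ENNReal.toReal_add (by finiteness) (by finiteness), ENNReal.toReal_mul,
    ENNReal.toReal_add (by finiteness) (by finiteness), ENNReal.toReal_mul,
    ENNReal.toReal_add (by finiteness) (by finiteness), ENNReal.toReal_mul,
    ENNReal.toReal_add (by finiteness) (by rwa [energy_comm hker hπ.1 hν.1]),
    ENNReal.toReal_mul, ENNReal.coe_toReal] at h
  rw [strDistSq]
  nlinarith [h]

end Energy

section IncreasingNets

variable {κ : X → X → ℝ≥0∞}

theorem nonpos_of_forall_two_mul_le {d e : ℝ} (he : 0 ≤ e)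
    (h : ∀ t : ℝ≥0, 2 * t * d ≤ t ^ 2 * e) : d ≤ 0 := by
  by_contra! hd
  have h1 := h ⟨d / (e + 1), by positivity⟩
  have he1 : 0 < e + 1 := by linarith
  change 2 * (d / (e + 1)) * d ≤ (d / (e + 1)) ^ 2 * e at h1
  have h2 : d / (e + 1) * (e + 1) = d := by field_simp
  set t := d / (e + 1)
  have htp : 0 < t := by positivity
  rw [← h2] at h1
  nlinarith [mul_pos htp htp, mul_nonneg (mul_pos htp htp).le he]

theorem energy_le_of_directed (hker : IsKernel κ) {α β γ : Measure X} (hα : IsRadon α)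
    (hγ : IsRadon γ) (h₁ : ∀ x, pot κ α x ≤ pot κ γ x) (h₂ : ∀ x, pot κ β x ≤ pot κ γ x) :
    energy κ α β ≤ energy κ γ γ :=
  (energy_mono_right h₂).trans ((energy_comm hker hα hγ).le.trans (energy_mono_right h₁))

theorem pot_le_iSup_of_vagueConv (hker : IsKernel κ) {c : ℕ → Measure X} {ν : Measure X}
    {U : Ultrafilter ℕ} (hc : ∀ n, IsRadon (c n)) (hν : IsRadon ν) (hconv : VagueConv U c ν)
    (x : X) : pot κ ν x ≤ ⨆ n, pot κ (c n) x :=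
  pot_le_of_vagueConv hker hc hν hconv fun n => le_iSup (fun n => pot κ (c n) x) n

theorem energy_le_iSup_of_vagueConv (hker : IsKernel κ) {c : ℕ → Measure X} {ν : Measure X}
    {U : Ultrafilter ℕ} (hc : ∀ n, IsRadon (c n)) (hν : IsRadon ν) (hconv : VagueConv U c ν)
    (hmono : Monotone fun n => pot κ (c n)) :
    energy κ ν ν ≤ ⨆ n, energy κ (c n) (c n) := by
  have hpot := pot_le_iSup_of_vagueConv hker hc hν hconv
  have key : ∀ ρ : Measure X, energy κ ρ ν ≤ ⨆ n, energy κ ρ (c n) := fun ρ =>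
    calc energy κ ρ ν ≤ ∫⁻ x, ⨆ n, pot κ (c n) x ∂ρ := lintegral_mono hpot
      _ = ⨆ n, energy κ ρ (c n) := lintegral_iSup (fun n => measurable_pot hker (hc n)) hmono
  refine (key ν).trans (iSup_le fun n => ?_)
  rw [energy_comm hker hν (hc n)]
  refine (key (c n)).trans (iSup_le fun m => ?_)
  exact (energy_le_of_directed hker (hc n) (hc (max n m)) (hmono (le_max_left n m))
    (hmono (le_max_right n m))).trans (le_iSup (fun n => energy κ (c n) (c n)) _)

theorem tendsto_strDistSq_of_vagueConv (hker : IsKernel κ) (hE : EnergyPrinciple κ)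
    (hcons : Consistent κ) {c : ℕ → Measure X} {ν : Measure X}
    {U : Ultrafilter ℕ} (hU : (U : Filter ℕ) ≤ atTop) (hc : ∀ n, c n ∈ Eplus κ)
    (hν : ν ∈ Eplus κ) (hconv : VagueConv U c ν)
    (hmono : Monotone fun n => pot κ (c n)) (hbdd : ⨆ n, energy κ (c n) (c n) ≠ ⊤) :
    Tendsto (fun n => strDistSq κ (c n) ν) atTop (𝓝 0) := by
  have hEmono : Monotone fun n => energy κ (c n) (c n) := fun m n hmn =>
    energy_self_mono hker (hc m).1 (hc n).1 (hmono hmn)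
  have hlim : Tendsto (fun n => (energy κ (c n) (c n)).toReal) atTop
      (𝓝 (⨆ n, energy κ (c n) (c n)).toReal) :=
    (ENNReal.tendsto_toReal hbdd).comp (tendsto_atTop_iSup hEmono)
  have hcau : StrongCauchy κ atTop c := by
    intro ε hε
    obtain ⟨N, hN⟩ := Metric.cauchySeq_iff.1 hlim.cauchySeq (ε ^ 2) (by positivity)
    have aux : ∀ i ≥ N, ∀ j ≥ N, i ≤ j → strDistSq κ (c i) (c j) < ε ^ 2 := by
      intro i hi j hj hij
      refine (strDistSq_le_of_pot_le hE (hc i) (hc j) (hmono hij)).trans_lt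
        ((le_abs_self _).trans_lt ?_)
      simpa [Real.dist_eq] using hN j hj i hi
    refine ⟨Ici N, Ici_mem_atTop N, fun i hi j hj => ?_⟩
    have hlt : strDistSq κ (c i) (c j) < ε ^ 2 := by
      rcases le_total i j with hij | hij
      · exact aux i hi j hj hij
      · rw [strDistSq_comm hker (hc i).1 (hc j).1]
        exact aux j hj i hi hij
    exact (Real.sqrt_lt' hε).2 hlt
  have h := (hcons ℕ atTop c inferInstance hc hcau ν ⟨U, hU, inferInstance, hconv⟩).pow 2
  rw [zero_pow two_ne_zero] at h
  refine h.congr fun n => ?_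
  exact Real.sq_sqrt (hE.strDistSq_nonneg (hc n) hν)

/-- A strong limit of majorants of a potential is itself a majorant, for increasing potentials. -/
theorem pot_le_of_strong_limit (hker : IsKernel κ) (hE : EnergyPrinciple κ) (hD : Domination κ)
    {c π : ℕ → Measure X} {α ν : Measure X} (hc : ∀ n, c n ∈ Eplus κ) (hπ : ∀ n, π n ∈ Eplus κ)
    (hα : α ∈ Eplus κ) (hν : ν ∈ Eplus κ) (hmono : Monotone fun n => pot κ (c n))
    (hνc : ∀ x, pot κ ν x ≤ ⨆ n, pot κ (c n) x)
    (hcπ : ∀ n x, pot κ (c n) x ≤ pot κ (π n) x) (hαπ : ∀ n x, pot κ α x ≤ pot κ (π n) x)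
    (hlim : Tendsto (fun n => strDistSq κ (π n) ν) atTop (𝓝 0)) (x : X) :
    pot κ α x ≤ pot κ ν x := by
  set g : ℕ → X → ℝ≥0∞ := fun n x => max (pot κ (c n) x) (pot κ α x)
  have hgm : Monotone g := fun m n hmn x => max_le_max (hmono hmn x) le_rfl
  have hgmeas : ∀ n, Measurable (g n) := fun n =>
    (measurable_pot hker (hc n).1).max (measurable_pot hker hα.1)
  have hgπ : ∀ n N, n ≤ N → ∫⁻ x, g n x ∂α ≤ energy κ α (π N) := fun n N hnN =>
    lintegral_mono fun x => max_le ((hmono hnN x).trans (hcπ N x)) (hαπ N x)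
  have hgν : ∀ n, ∫⁻ x, g n x ∂α ≤ energy κ α ν := by
    intro n
    have hfin : ∫⁻ x, g n x ∂α ≠ ⊤ :=
      ((hgπ n n le_rfl).trans_lt (hE.energy_ne_top hα (hπ n)).lt_top).ne
    refine (ENNReal.toReal_le_toReal hfin (hE.energy_ne_top hα hν)).1 (sub_nonpos.1 ?_)
    refine nonpos_of_forall_two_mul_le (e := (energy κ α α).toReal) ENNReal.toReal_nonneg
      fun t => ?_
    have hl : Tendsto (fun N => (t : ℝ) ^ 2 * (energy κ α α).toReal + strDistSq κ (π N) ν) atTop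
        (𝓝 ((t : ℝ) ^ 2 * (energy κ α α).toReal + 0)) := tendsto_const_nhds.add hlim
    rw [add_zero] at hl
    refine ge_of_tendsto hl (eventually_atTop.2 ⟨n, fun N hN => ?_⟩)
    refine le_trans ?_ (two_mul_energy_sub_le hker hE hα (hπ N) hν t)
    have := ENNReal.toReal_mono (hE.energy_ne_top hα (hπ N)) (hgπ n N hN)
    gcongr
  have hle : ∀ x, pot κ ν x ≤ ⨆ n, g n x := fun x =>
    (hνc x).trans (iSup_mono fun n => le_max_left _ _)
  have hsup : ∫⁻ x, ⨆ n, g n x ∂α ≤ ∫⁻ x, pot κ ν x ∂α := by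
    rw [lintegral_iSup hgmeas hgm]
    exact iSup_le hgν
  have hae := ae_eq_of_ae_le_of_lintegral_le (ae_of_all α hle) (hE.energy_ne_top hα hν)
    (Measurable.iSup hgmeas).aemeasurable hsup
  refine hD α hα ν hν ?_ x
  filter_upwards [hae] with y hy
  rw [hy]
  exact (le_max_right _ _).trans (le_iSup (fun n => g n y) 0)

variable {ι : Type*} [Preorder ι] [IsDirectedOrder ι]

theorem exists_monotone_seq_tendsto_iSup [Nonempty ι] {e : ι → ℝ≥0∞} (he : Monotone e)
    {P : ι → Prop} (hP : ∀ i, ∃ j, i ≤ j ∧ P j) :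
    ∃ s : ℕ → ι, Monotone s ∧ (∀ n, P (s n)) ∧ Tendsto (e ∘ s) atTop (𝓝 (⨆ i, e i)) := by
  obtain ⟨u, -, hu, hmem⟩ := exists_seq_tendsto_sSup (range_nonempty e) (OrderTop.bddAbove _)
  choose v hv using hmem
  have hstep : ∀ i j : ι, ∃ k, i ≤ k ∧ j ≤ k ∧ P k := fun i j => by
    obtain ⟨k, hik, hjk⟩ := exists_ge_ge i j
    obtain ⟨l, hkl, hl⟩ := hP k
    exact ⟨l, hik.trans hkl, hjk.trans hkl, hl⟩
  choose w hw₁ hw₂ hw₃ using hstep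
  let s : ℕ → ι := fun n => Nat.rec (w (v 0) (v 0)) (fun n a => w a (v (n + 1))) n
  have hs : ∀ n, v n ≤ s n ∧ P (s n) := by
    rintro (_ | n)
    · exact ⟨hw₁ _ _, hw₃ _ _⟩
    · exact ⟨hw₂ _ _, hw₃ _ _⟩
  refine ⟨s, monotone_nat_of_le_succ fun n => hw₁ _ _, fun n => (hs n).2, ?_⟩
  refine tendsto_of_tendsto_of_tendsto_of_le_of_le hu tendsto_const_nhds (fun n => ?_)
    (fun n => le_iSup e (s n))
  rw [← hv n]
  exact he (hs n).1

theorem exists_vagueConv_seq (hker : IsKernel κ) (hE : EnergyPrinciple κ) {b : ι → Measure X}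
    (hb : ∀ i, b i ∈ Eplus κ) {C : ℝ≥0∞} (hC : C ≠ ⊤) (hbC : ∀ i, energy κ (b i) (b i) ≤ C)
    (s : ℕ → ι) (U : Ultrafilter ℕ) : ∃ ν, IsRadon ν ∧ VagueConv (U : Filter ℕ) (b ∘ s) ν := by
  refine exists_vagueConv_ultrafilter U (fun n => (hb (s n)).1) fun K hK => ?_
  obtain ⟨D, hDm⟩ := exists_measure_le_of_energy_le hker hE hC hK
  exact ⟨D, fun n => hDm _ (hbC _)⟩

/-- Vague limits of energy-exhausting sequences extracted from an increasing net. -/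
theorem pot_eq_iSup_of_vagueConv (hker : IsKernel κ) (hE : EnergyPrinciple κ)
    (hcons : Consistent κ) (hD : Domination κ) {b : ι → Measure X} (hb : ∀ i, b i ∈ Eplus κ)
    (hmono : Monotone fun i => pot κ (b i)) (hbdd : ⨆ i, energy κ (b i) (b i) ≠ ⊤)
    {s : ℕ → ι} (hs : Monotone s)
    (hlim : Tendsto (fun n => energy κ (b (s n)) (b (s n))) atTop
      (𝓝 (⨆ i, energy κ (b i) (b i))))
    {U : Ultrafilter ℕ} (hU : (U : Filter ℕ) ≤ atTop) {ν : Measure X} (hν : IsRadon ν)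
    (hconv : VagueConv (U : Filter ℕ) (b ∘ s) ν) :
    ν ∈ Eplus κ ∧ (∀ x, pot κ ν x = ⨆ i, pot κ (b i) x) ∧
      energy κ ν ν = ⨆ i, energy κ (b i) (b i) := by
  set S := ⨆ i, energy κ (b i) (b i)
  have hle : ∀ i, energy κ (b i) (b i) ≤ S := le_iSup fun i => energy κ (b i) (b i)
  have hcmono : Monotone fun n => pot κ ((b ∘ s) n) := hmono.comp hs
  have hSc : ⨆ n, energy κ ((b ∘ s) n) ((b ∘ s) n) ≤ S := iSup_le fun n => hle _
  have hνS := (energy_le_iSup_of_vagueConv hker (fun n => (hb _).1) hν hconv hcmono).trans hSc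
  have hνE : ν ∈ Eplus κ := ⟨hν, hνS.trans_lt hbdd.lt_top⟩
  have hνle := pot_le_iSup_of_vagueConv hker (c := b ∘ s) (fun n => (hb _).1) hν hconv
  have hdist := tendsto_strDistSq_of_vagueConv hker hE hcons hU (fun n => hb (s n)) hνE hconv
    hcmono (hSc.trans_lt hbdd.lt_top).ne
  have hge : ∀ j x, pot κ (b j) x ≤ pot κ ν x := by
    intro j
    choose r hr₁ hr₂ using fun n => exists_ge_ge (s n) j
    refine pot_le_of_strong_limit (c := b ∘ s) (π := b ∘ r) hker hE hD (fun n => hb _)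
      (fun n => hb _) (hb j) hνE hcmono hνle (fun n => hmono (hr₁ n)) (fun n => hmono (hr₂ n)) ?_
    have hup : Tendsto (fun n => S.toReal - (energy κ (b (s n)) (b (s n))).toReal +
        strDistSq κ (b (s n)) ν) atTop (𝓝 (S.toReal - S.toReal + 0)) :=
      (tendsto_const_nhds.sub ((ENNReal.tendsto_toReal hbdd).comp hlim)).add hdist
    rw [sub_self, add_zero] at hup
    refine squeeze_zero (fun n => hE.strDistSq_nonneg (hb _) hνE) (fun n => ?_) hup
    have h₁ := ENNReal.toReal_mono hbdd (hle (r n))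
    have h₂ : energy κ (b (s n)) ν ≤ energy κ (b (r n)) ν := by
      rw [energy_comm hker (hb _).1 hν, energy_comm hker (hb _).1 hν]
      exact energy_mono_right (hmono (hr₁ n))
    have h₃ := ENNReal.toReal_mono (hE.energy_ne_top (hb _) hνE) h₂
    simp only [strDistSq, Function.comp_apply]
    linarith
  refine ⟨hνE, fun x => le_antisymm ((hνle x).trans ?_) (iSup_le fun j => hge j x),
    le_antisymm hνS (iSup_le fun j => energy_self_mono hker (hb j).1 hν (hge j))⟩
  exact iSup_le fun n => le_iSup (fun i => pot κ (b i) x) (s n)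

/-- An increasing net of potentials with bounded energies converges pointwise, strongly and
vaguely to the potential of a measure of finite energy. -/
theorem exists_limit_of_monotone_pot [Nonempty ι] (hker : IsKernel κ) (hE : EnergyPrinciple κ)
    (hcons : Consistent κ) (hD : Domination κ) {b : ι → Measure X} (hb : ∀ i, b i ∈ Eplus κ)
    (hmono : Monotone fun i => pot κ (b i)) (hbdd : ⨆ i, energy κ (b i) (b i) ≠ ⊤) :
    ∃ ν ∈ Eplus κ, (∀ x, pot κ ν x = ⨆ i, pot κ (b i) x) ∧
      Tendsto (fun i => strDist κ (b i) ν) atTop (𝓝 0) ∧ VagueConv atTop b ν := by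
  have hle : ∀ i, energy κ (b i) (b i) ≤ ⨆ i, energy κ (b i) (b i) :=
    le_iSup fun i => energy κ (b i) (b i)
  have hEmono : Monotone fun i => energy κ (b i) (b i) := fun i j hij =>
    energy_self_mono hker (hb i).1 (hb j).1 (hmono hij)
  have hUtop : ((hyperfilter ℕ : Ultrafilter ℕ) : Filter ℕ) ≤ atTop := by
    rw [← Nat.cofinite_eq_atTop]; exact hyperfilter_le_cofinite
  obtain ⟨s, hs, -, hlim⟩ := exists_monotone_seq_tendsto_iSup hEmono (P := fun _ => True)
    fun i => ⟨i, le_rfl, trivial⟩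
  obtain ⟨ν, hν, hconv⟩ := exists_vagueConv_seq hker hE hb hbdd hle s (hyperfilter ℕ)
  obtain ⟨hνE, hpot, hen⟩ := pot_eq_iSup_of_vagueConv hker hE hcons hD hb hmono hbdd hs hlim
    hUtop hν hconv
  refine ⟨ν, hνE, hpot, ?_, fun f hf hfc => ?_⟩
  · have hup : Tendsto (fun i => (energy κ ν ν).toReal - (energy κ (b i) (b i)).toReal) atTop
        (𝓝 ((energy κ ν ν).toReal - (energy κ ν ν).toReal)) := by
      refine tendsto_const_nhds.sub ((ENNReal.tendsto_toReal hνE.2.ne).comp ?_)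
      rw [hen]
      exact tendsto_atTop_iSup hEmono
    rw [sub_self] at hup
    have hsq : Tendsto (fun i => strDistSq κ (b i) ν) atTop (𝓝 0) :=
      squeeze_zero (fun i => hE.strDistSq_nonneg (hb i) hνE)
        (fun i => strDistSq_le_of_pot_le hE (hb i) hνE fun x => by
          rw [hpot]; exact le_iSup (fun i => pot κ (b i) x) i) hup
    have h := (Real.continuous_sqrt.tendsto 0).comp hsq
    rw [Real.sqrt_zero] at h
    exact h
  · by_contra hnot
    simp only [Metric.tendsto_nhds, eventually_atTop] at hnot
    push Not at hnot
    obtain ⟨ε, hε, hfreq⟩ := hnot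
    obtain ⟨s', hs', hfar, hlim'⟩ := exists_monotone_seq_tendsto_iSup hEmono hfreq
    obtain ⟨ν', hν', hconv'⟩ := exists_vagueConv_seq hker hE hb hbdd hle s' (hyperfilter ℕ)
    obtain ⟨hνE', hpot', -⟩ := pot_eq_iSup_of_vagueConv hker hE hcons hD hb hmono hbdd hs' hlim'
      hUtop hν' hconv'
    obtain rfl := hE.eq_of_pot_eq hker hνE' hνE fun x => by rw [hpot, hpot']
    obtain ⟨n, hn⟩ := ((hconv' f hf hfc).eventually (Metric.ball_mem_nhds _ hε)).exists
    exact absurd hn (not_lt.2 (hfar n))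

end IncreasingNets

section InnerCapacity

variable {κ : X → X → ℝ≥0∞}

theorem ConcOn.measure_compl_eq_zero {m : Measure X} (hm : IsRadon m) {E : Set X}
    (h : ConcOn m E) : m Eᶜ = 0 := by
  have := hm.1
  obtain ⟨T, hTE, hT, hae⟩ := h.1.compl.exists_measurable_subset_ae_eq
  rw [← measure_congr hae]
  by_contra hpos
  obtain ⟨K, hKT, hK, hlt⟩ := hT.exists_lt_isCompact (pos_iff_ne_zero.2 hpos)
  refine hlt.not_ge ((measure_mono ?_).trans (h.2 K hK).le)
  exact subset_inter (hKT.trans hTE) Subset.rfl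

theorem concOn_of_measure_compl_eq_zero {m : Measure X} {E : Set X} (h : m Eᶜ = 0) :
    ConcOn m E :=
  ⟨(NullMeasurableSet.of_null h).of_compl, fun _ _ => measure_mono_null inter_subset_left h⟩

theorem innerCap_eq_zero_iff {E : Set X} :
    innerCap κ E = 0 ↔ ∀ m ∈ EplusOn κ E, m univ ≠ 1 := by
  simp only [innerCap, ENNReal.inv_eq_zero, iInf_eq_top, mem_ofPred_eq, and_imp]
  exact forall₂_congr fun m hm => ⟨fun h h₁ => hm.1.2.ne (h h₁), fun h h₁ => absurd h₁ h⟩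

theorem innerCap_eq_zero_mono {E F : Set X} (hEF : E ⊆ F) (hF : innerCap κ F = 0) :
    innerCap κ E = 0 := by
  rw [innerCap_eq_zero_iff] at hF ⊢
  refine fun m hm => hF m ⟨hm.1, concOn_of_measure_compl_eq_zero ?_⟩
  exact measure_mono_null (compl_subset_compl.2 hEF) (hm.2.measure_compl_eq_zero hm.1.1)

theorem innerLam_anti {A B : Set X} (hAB : A ⊆ B) (μ : Measure X) :
    InnerLam κ B μ ⊆ InnerLam κ A μ := by
  refine fun ν hν => ⟨hν.1, innerCap_eq_zero_mono ?_ hν.2⟩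
  exact fun x hx => ⟨hAB hx.1, hx.2⟩

/-- Inner capacity zero is determined by compact subsets. -/
theorem innerCap_eq_zero_of_isCompact {E : Set X}
    (h : ∀ K, IsCompact K → K ⊆ E → innerCap κ K = 0) : innerCap κ E = 0 := by
  rw [innerCap_eq_zero_iff]
  intro m hm h1
  have hrad := hm.1.1
  have := hrad.1
  have : IsFiniteMeasure m := ⟨by simp [h1]⟩
  have hE0 := hm.2.measure_compl_eq_zero hrad
  obtain ⟨T, hTE, hT, hae⟩ := hm.2.1.exists_measurable_subset_ae_eq
  have hmT : m T = 1 := by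
    rw [measure_congr hae, ← h1]
    exact measure_of_measure_compl_eq_zero hE0
  obtain ⟨K, hKT, hK, hpos⟩ := hT.exists_lt_isCompact (hmT.symm ▸ zero_lt_one)
  have hc : (m K)⁻¹ ≠ ⊤ := ENNReal.inv_ne_top.2 hpos.ne'
  have hres : IsRadon (m.restrict K) := ⟨inferInstance, inferInstance⟩
  have hle : m.restrict K ≤ m := Measure.restrict_le_self
  refine innerCap_eq_zero_iff.1 (h K hK (hKT.trans hTE)) ((m K)⁻¹ • m.restrict K)
    ⟨⟨hres.smul hc, ?_⟩, concOn_of_measure_compl_eq_zero ?_⟩ ?_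
  · have hpot : ∀ x, pot κ ((m K)⁻¹ • m.restrict K) x ≤ (m K)⁻¹ * pot κ m x := fun x => by
      rw [pot, lintegral_smul_measure, smul_eq_mul]
      gcongr
      exact lintegral_mono' hle le_rfl
    rw [energy_smul_left]
    refine ENNReal.mul_lt_top hc.lt_top ?_
    calc energy κ (m.restrict K) ((m K)⁻¹ • m.restrict K)
        ≤ ∫⁻ x, (m K)⁻¹ * pot κ m x ∂m := lintegral_mono' hle hpot
      _ = (m K)⁻¹ * energy κ m m := lintegral_const_mul' _ _ hc
      _ < ⊤ := ENNReal.mul_lt_top hc.lt_top hm.1.2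
  · simp [Measure.restrict_apply hK.measurableSet.compl]
  · simp [ENNReal.inv_mul_cancel hpos.ne' (measure_ne_top m K)]

end InnerCapacity

/-- Convergence of inner balayages onto compact subsets: `μ^K → μ^A` strongly and
vaguely, and `κμ^K ↑ κμ^A` pointwise, as `K ↑ A`. -/
theorem statement3 (κ : X → X → ℝ≥0∞) (hker : IsKernel κ)
    (hE : EnergyPrinciple κ) (hC : Consistent κ) (hD : Domination κ)
    (μ : Measure X) (hμ : μ ∈ Eplus κ) (A : Set X)
    (bal : {K : Set X // IsCompact K ∧ K ⊆ A} → Measure X)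
    (hbal : ∀ K : {K : Set X // IsCompact K ∧ K ⊆ A}, IsInnerBal κ (K : Set X) μ (bal K))
    (bA : Measure X) (hbA : IsInnerBal κ A μ bA) :
    Tendsto (fun K => strDist κ (bal K) bA) atTop (nhds (0 : ℝ)) ∧
    VagueConv atTop bal bA ∧
    (∀ K₁ K₂ : {K : Set X // IsCompact K ∧ K ⊆ A}, K₁ ≤ K₂ →
      ∀ x, pot κ (bal K₁) x ≤ pot κ (bal K₂) x) ∧
    (∀ x, pot κ bA x = ⨆ K : {K : Set X // IsCompact K ∧ K ⊆ A}, pot κ (bal K) x) ∧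
    (∀ x, Tendsto (fun K => pot κ (bal K) x) atTop (nhds (pot κ bA x))) := by
  let I := {K : Set X // IsCompact K ∧ K ⊆ A}
  have : Nonempty I := ⟨⟨∅, isCompact_empty, empty_subset A⟩⟩
  have : IsDirectedOrder I := ⟨fun K L =>
    ⟨⟨K.1 ∪ L.1, K.2.1.union L.2.1, union_subset K.2.2 L.2.2⟩,
      subset_union_left, subset_union_right⟩⟩
  have hb : ∀ K, bal K ∈ Eplus κ := fun K => (hbal K).1.1
  have hmono : Monotone fun K => pot κ (bal K) := fun K L hKL =>
    (hbal K).2 _ (innerLam_anti hKL μ (hbal L).1)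
  have hle : ∀ K x, pot κ (bal K) x ≤ pot κ bA x := fun K =>
    (hbal K).2 _ (innerLam_anti K.2.2 μ hbA.1)
  have hbdd : ⨆ K, energy κ (bal K) (bal K) ≠ ⊤ :=
    ((iSup_le fun K => energy_self_mono hker (hb K).1 hbA.1.1.1 (hle K)).trans_lt
      hbA.1.1.2).ne
  obtain ⟨ν, hν, hpot, hstrong, hvague⟩ :=
    exists_limit_of_monotone_pot hker hE hC hD hb hmono hbdd
  have hνA : ν ∈ InnerLam κ A μ := by
    refine ⟨hν, innerCap_eq_zero_of_isCompact fun K hK hKN => ?_⟩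
    let L : I := ⟨K, hK, fun x hx => (hKN hx).1⟩
    have hL : innerCap κ {x | x ∈ K ∧ ¬ pot κ μ x ≤ pot κ (bal L) x} = 0 := (hbal L).1.2
    refine innerCap_eq_zero_mono ?_ hL
    refine fun x hx => ⟨hx, fun hxL => (hKN hx).2 ?_⟩
    change pot κ μ x ≤ pot κ ν x
    rw [hpot]
    exact hxL.trans (le_iSup (fun K => pot κ (bal K) x) L)
  obtain rfl : ν = bA := hE.eq_of_pot_eq hker hν hbA.1.1 fun x =>
    le_antisymm (by rw [hpot]; exact iSup_le fun K => hle K x) (hbA.2 ν hνA x)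
  refine ⟨hstrong, hvague, hmono, hpot, fun x => ?_⟩
  rw [hpot]
  exact tendsto_atTop_iSup fun K L hKL => hmono hKL x

end Balayage
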